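/- There exists, for each n ≥ 1, a bijection φ_n from the set of ≡_{2,4}-equivalence classes of binary trees of arity n to the set of integer compositions of arity n, such that φ_1 sends the class of the leaf to the empty composition ε and, for all binary trees t of arity n, t' of arity m, and 1 ≤ i ≤ n, φ_{n+m−1}([t ∘_i t']) = φ_n([t]) ∘_i^{(2,4)} φ_m([t']). Here, for compositions λ = (λ_1, …, λ_p) of arity n and nonempty μ = (μ_1, …, μ_q) of arity m, with k ≥ 0 the largest index such that s_{1,k}(λ) ≤ i: λ ∘_i^{(2,4)} μ := (λ_1, …, λ_k, μ_1, …, μ_{q−1}, μ_q + λ_{k+1}, λ_{k+2}, …, λ_p) if i = s_{1,k}(λ) (with λ_{k+1} read as 0 when k = p, i.e. when i = n the result is the concatenation (λ_1, …, λ_p, μ_1, …, μ_q)), and λ ∘_i^{(2,4)} μ := (λ_1, …, λ_k, i − s_{1,k}(λ), μ_1, …, μ_{q−1}, μ_q + s_{1,k+1}(λ) − i, λ_{k+2}, …, λ_p) otherwise; by convention λ ∘_i^{(2,4)} ε = λ. (Thus the operad of integer compositions with these partial compositions is a combinatorial realization of Mag^{{2,4}}.) -/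

import Mathlib

/-- A binary tree: either a leaf or an ordered pair of binary trees. -/
inductive BTree : Type
  | leaf : BTree
  | node : BTree → BTree → BTree
  deriving DecidableEq

namespace BTree

/-- The arity of a binary tree is its number of leaves. -/
def arity : BTree → ℕ
  | leaf => 1
  | node l r => arity l + arity r

/-- The degree of a binary tree is its number of internal nodes. -/
def degree : BTree → ℕ
  | leaf => 0
  | node l r => degree l + degree r + 1

/-- Grafting `t ∘ᵢ s`: identify the root of `s` with the `i`-th leaf of `t`
(leaves numbered from left to right, starting at `1`). -/
def graft : BTree → ℕ → BTree → BTree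
  | leaf, i, s => if i = 1 then s else leaf
  | node l r, i, s =>
      if i ≤ l.arity then node (l.graft i s) r else node l (r.graft (i - l.arity) s)

/-- Simultaneous grafting `s ∘ [r_1, …, r_n]`: graft the `i`-th element of the
list onto the `i`-th leaf of `s`, simultaneously. -/
def multigraft : BTree → List BTree → BTree
  | leaf, rs => rs.headD leaf
  | node l r, rs => node (l.multigraft (rs.take l.arity)) (r.multigraft (rs.drop l.arity))

/-- The left comb with `γ` internal nodes. -/
def leftComb : ℕ → BTree
  | 0 => leaf
  | γ + 1 => node (leftComb γ) leaf

/-- The right comb with `γ` internal nodes. -/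
def rightComb : ℕ → BTree
  | 0 => leaf
  | γ + 1 => node leaf (rightComb γ)

/-- The prefix word of a binary tree, over the alphabet `{0, 2}`:
a left-to-right depth-first traversal writes `2` for each internal node and
`0` for each leaf. -/
def prefixWord : BTree → List ℕ
  | leaf => [0]
  | node l r => 2 :: (prefixWord l ++ prefixWord r)

/-- The left rank: number of internal nodes on the leftmost branch from the root. -/
def leftRank : BTree → ℕ
  | leaf => 0
  | node l _ => leftRank l + 1

/-- The mirror of a binary tree. -/
def mirror : BTree → BTree
  | leaf => leaf
  | node l r => node (mirror r) (mirror l)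

end BTree

/-- One step of the rewrite relation induced by a set of rewrite rules `R`:
`r ∘ᵢ (s ∘ [r_1, …, r_n]) ⇒ r ∘ᵢ (s' ∘ [r_1, …, r_n])` whenever `R s s'`. -/
def Step (R : BTree → BTree → Prop) (t t' : BTree) : Prop :=
  ∃ (s s' r : BTree) (i : ℕ) (rs : List BTree),
    R s s' ∧ 1 ≤ i ∧ i ≤ r.arity ∧ rs.length = s.arity ∧
    t = r.graft i (s.multigraft rs) ∧ t' = r.graft i (s'.multigraft rs)

/-- The congruence generated by a set of rewrite rules: the reflexive–symmetric–transitive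
closure of the induced rewrite relation. -/
def CongrGen (R : BTree → BTree → Prop) : BTree → BTree → Prop :=
  Relation.EqvGen (Step R)

/-- The tree `s` occurs as a subtree of `t`. -/
def Occurs (s t : BTree) : Prop :=
  ∃ (r : BTree) (i : ℕ) (rs : List BTree),
    1 ≤ i ∧ i ≤ r.arity ∧ rs.length = s.arity ∧ t = r.graft i (s.multigraft rs)

/-- The rewrite relation induced by `R` is terminating: there is no infinite
chain `t_0 ⇒ t_1 ⇒ t_2 ⇒ ⋯`. -/
def Terminating (R : BTree → BTree → Prop) : Prop :=
  ¬ ∃ f : ℕ → BTree, ∀ n, Step R (f n) (f (n + 1))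

/-- The rewrite relation induced by `R` is confluent. -/
def Confluent (R : BTree → BTree → Prop) : Prop :=
  ∀ t s₁ s₂, Relation.ReflTransGen (Step R) t s₁ → Relation.ReflTransGen (Step R) t s₂ →
    ∃ t', Relation.ReflTransGen (Step R) s₁ t' ∧ Relation.ReflTransGen (Step R) s₂ t'

/-- The number of equivalence classes of binary trees of arity `n` under the
equivalence relation `E`. -/
noncomputable def classCount (E : BTree → BTree → Prop) (n : ℕ) : ℕ :=
  Nat.card (Quot fun a b : {t : BTree // t.arity = n} => E a.1 b.1)

/-- The congruence `≡_γ` generated by the single rewrite rule `(L_γ, R_γ)`. -/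
def CAsCongr (γ : ℕ) : BTree → BTree → Prop :=
  CongrGen fun s s' => s = BTree.leftComb γ ∧ s' = BTree.rightComb γ

/-- The five binary trees of degree `3`, in increasing lexicographic order of
their prefix words: `cubic 1` has prefix word `2020200` (the right comb), …,
`cubic 5` has prefix word `2220000` (the left comb). -/
def cubic : ℕ → BTree
  | 1 => .node .leaf (.node .leaf (.node .leaf .leaf))
  | 2 => .node .leaf (.node (.node .leaf .leaf) .leaf)
  | 3 => .node (.node .leaf .leaf) (.node .leaf .leaf)
  | 4 => .node (.node .leaf (.node .leaf .leaf)) .leaf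
  | 5 => .node (.node (.node .leaf .leaf) .leaf) .leaf
  | _ => .leaf

/-- The congruence `≡_{i,j}` generated by the single rewrite rule `(𝔞_i, 𝔞_j)`. -/
def MagCongr (i j : ℕ) : BTree → BTree → Prop :=
  CongrGen fun s s' => s = cubic i ∧ s' = cubic j

namespace List

/-- Add `x` to the last entry of a list, the empty list becoming `[x]`. -/
def addLast (x : ℕ) : List ℕ → List ℕ
  | [] => [x]
  | [a] => [a + x]
  | a :: b :: l => a :: addLast x (b :: l)

lemma addLast_append (x : ℕ) (u : List ℕ) {v : List ℕ} (hv : v ≠ []) :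
    addLast x (u ++ v) = u ++ addLast x v := by
  induction u with
  | nil => rfl
  | cons a u ih =>
    obtain ⟨b, w, hw⟩ := List.exists_cons_of_ne_nil (List.append_ne_nil_of_right_ne_nil u hv)
    rw [cons_append, cons_append, ← ih, hw, addLast]

lemma addLast_concat (x : ℕ) (u : List ℕ) (a : ℕ) :
    addLast x (u ++ [a]) = u ++ [a + x] :=
  addLast_append x u (by simp)

lemma addLast_cons (x a : ℕ) {v : List ℕ} (hv : v ≠ []) :
    addLast x (a :: v) = a :: addLast x v :=
  addLast_append x [a] hv

lemma addLast_ne_nil (x : ℕ) (u : List ℕ) : addLast x u ≠ [] := by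
  match u with
  | [] | [_] | _ :: _ :: _ => simp [addLast]

lemma addLast_eq (x : ℕ) {u : List ℕ} (hu : u ≠ []) :
    addLast x u = u.dropLast ++ [u.getLastD 0 + x] := by
  induction u using List.reverseRecOn with
  | nil => exact absurd rfl hu
  | append_singleton u a _ => simp [addLast_concat]

lemma addLast_addLast (x y : ℕ) {u : List ℕ} (hu : u ≠ []) :
    addLast x (addLast y u) = addLast (y + x) u := by
  induction u using List.reverseRecOn with
  | nil => exact absurd rfl hu
  | append_singleton u a _ => simp [addLast_concat, add_assoc]

lemma sum_addLast (x : ℕ) (u : List ℕ) : (addLast x u).sum = u.sum + x := by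
  induction u using List.reverseRecOn with
  | nil => simp [addLast]
  | append_singleton u a _ => simp [addLast_concat, add_assoc]

lemma pos_of_mem_addLast {x : ℕ} (hx : 0 < x) {u : List ℕ} (hu : ∀ a ∈ u, 0 < a) :
    ∀ a ∈ addLast x u, 0 < a := by
  induction u using List.reverseRecOn with
  | nil => simpa [addLast] using hx
  | append_singleton u b _ =>
    intro a ha
    rw [addLast_concat] at ha
    simp only [mem_append, mem_singleton] at ha
    rcases ha with ha | rfl
    · exact hu a (by simp [ha])
    · omega

/-- Insert the composition `μ` at distance `j` from the beginning of a composition. -/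
def insertComp : List ℕ → ℕ → List ℕ → List ℕ
  | [], _, μ => μ
  | x :: l, j, μ =>
      if j = 0 then addLast x μ ++ l
      else if j < x then j :: (addLast (x - j) μ ++ l)
      else x :: insertComp l (j - x) μ

lemma insertComp_append (a v : List ℕ) (j : ℕ) (μ : List ℕ) (ha : ∀ x ∈ a, 0 < x) :
    insertComp (a ++ v) (a.sum + j) μ = a ++ insertComp v j μ := by
  induction a with
  | nil => simp
  | cons x a ih =>
    have hx : 0 < x := ha x (by simp)
    rw [cons_append, insertComp, if_neg (by simp; omega), if_neg (by simp; omega), cons_append,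
      ← ih fun y hy => ha y (by simp [hy])]
    congr 2
    simp; omega

lemma insertComp_ne_nil (u : List ℕ) (j : ℕ) {μ : List ℕ} (hμ : μ ≠ []) :
    insertComp u j μ ≠ [] := by
  cases u with
  | nil => exact hμ
  | cons x u =>
    rw [insertComp]
    split_ifs <;> simp [addLast_ne_nil]

lemma insertComp_addLast_append {u : List ℕ} (hu : u ≠ []) (hpos : ∀ x ∈ u, 0 < x)
    (v : List ℕ) {j : ℕ} (hj : j ≤ u.sum) {μ : List ℕ} (hμ : μ ≠ []) :
    insertComp (addLast 1 u ++ v) j μ = addLast 1 (insertComp u j μ) ++ v := by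
  induction u generalizing j with
  | nil => exact absurd rfl hu
  | cons x u ih =>
    have hx : 0 < x := hpos x (by simp)
    rcases eq_or_ne u [] with rfl | hne
    · simp only [sum_cons, sum_nil, add_zero] at hj
      simp only [addLast, cons_append, nil_append, insertComp, append_nil]
      rcases Nat.eq_zero_or_pos j with rfl | hj0
      · simp [addLast_addLast _ _ hμ]
      · rcases hj.lt_or_eq with hlt | rfl
        · rw [if_neg (by omega), if_pos (by omega), if_neg (by omega), if_pos hlt,
            addLast_cons _ _ (addLast_ne_nil _ _), addLast_addLast _ _ hμ,
            show x - j + 1 = x + 1 - j by omega, cons_append]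
        · rw [if_neg (by omega), if_pos (by omega), if_neg (by omega), if_neg (by omega),
            addLast_cons _ _ hμ]
          simp
    · rw [addLast_cons _ _ hne, cons_append, insertComp, insertComp]
      split_ifs with h0 h1
      · rw [addLast_append _ _ hne, append_assoc]
      · rw [addLast_cons _ _ (append_ne_nil_of_right_ne_nil _ hne), addLast_append _ _ hne]
        simp
      · rw [addLast_cons _ _ (insertComp_ne_nil _ _ hμ), cons_append,
          ih hne (fun y hy => hpos y (by simp [hy])) (by simp at hj; omega)]

lemma insertComp_sum_take {l : List ℕ} (hl : ∀ x ∈ l, 0 < x) {μ : List ℕ} (hμ : μ ≠ [])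
    (k : ℕ) :
    insertComp l (l.take k).sum μ =
      l.take k ++ μ.dropLast ++ (μ.getLastD 0 + l.getD k 0) :: l.drop (k + 1) := by
  have h := insertComp_append (l.take k) (l.drop k) 0 μ fun x hx => hl x (mem_of_mem_take hx)
  rw [take_append_drop, add_zero] at h
  rw [h, append_assoc]
  congr 1
  rcases lt_or_ge k l.length with hk | hk
  · rw [drop_eq_getElem_cons hk, insertComp, if_pos rfl, addLast_eq _ hμ]
    simp [hk]
  · rw [drop_eq_nil_of_le hk, drop_eq_nil_of_le (by omega), insertComp]
    conv_lhs => rw [← dropLast_append_getLast hμ]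
    simp [getElem?_eq_none hk, getLastD_eq_getLast?, getLast?_eq_getLast_of_ne_nil hμ]

lemma insertComp_of_lt_of_lt {l : List ℕ} (hl : ∀ x ∈ l, 0 < x) {μ : List ℕ} (hμ : μ ≠ [])
    {j k : ℕ} (h₁ : (l.take k).sum < j) (h₂ : j < (l.take (k + 1)).sum) :
    insertComp l j μ =
      l.take k ++ (j - (l.take k).sum) ::
        (μ.dropLast ++ (μ.getLastD 0 + ((l.take (k + 1)).sum - j)) :: l.drop (k + 1)) := by
  have hk : k < l.length := by
    by_contra! hk
    rw [take_of_length_le hk] at h₁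
    rw [take_of_length_le (by omega)] at h₂
    omega
  have h := insertComp_append (l.take k) (l.drop k) (j - (l.take k).sum) μ
    fun x hx => hl x (mem_of_mem_take hx)
  rw [take_append_drop, Nat.add_sub_cancel' h₁.le] at h
  rw [sum_take_succ _ _ hk] at h₂ ⊢
  rw [h, drop_eq_getElem_cons hk, insertComp, if_neg (by omega), if_pos (by omega),
    addLast_eq _ hμ, append_assoc, singleton_append,
    show l[k] - (j - (l.take k).sum) = (l.take k).sum + l[k] - j by omega]

end List

namespace BTree

lemma arity_pos (t : BTree) : 0 < t.arity := by
  induction t with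
  | leaf => simp [arity]
  | node l r hl _ => rw [arity]; omega

lemma graft_leaf (t : BTree) (i : ℕ) : t.graft i leaf = t := by
  induction t generalizing i with
  | leaf => simp [graft]
  | node l r hl hr => simp [graft, hl, hr]

/-- The integer composition encoding the `≡_{2,4}`-class of a binary tree. -/
def toComp : BTree → List ℕ
  | leaf => []
  | node l r => l.toComp.addLast 1 ++ r.toComp

lemma toComp_pos (t : BTree) : ∀ x ∈ t.toComp, 0 < x := by
  induction t with
  | leaf => simp [toComp]
  | node l r hl hr =>
    intro x hx
    rcases List.mem_append.1 hx with hx | hx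
    · exact List.pos_of_mem_addLast one_pos hl x hx
    · exact hr x hx

lemma sum_toComp (t : BTree) : 1 + t.toComp.sum = t.arity := by
  induction t with
  | leaf => simp [toComp, arity]
  | node l r hl hr =>
    rw [toComp, arity, List.sum_append, List.sum_addLast]
    omega

lemma toComp_node_ne_nil (l r : BTree) : (node l r).toComp ≠ [] := by
  simp [toComp, List.addLast_ne_nil]

lemma toComp_eq_nil {t : BTree} : t.toComp = [] ↔ t = leaf := by
  cases t with
  | leaf => simp [toComp]
  | node l r => simp [toComp_node_ne_nil]

lemma toComp_graft (t : BTree) {t' : BTree} (ht' : t'.toComp ≠ []) {j : ℕ} (hj : j < t.arity) :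
    (t.graft (j + 1) t').toComp = t.toComp.insertComp j t'.toComp := by
  induction t generalizing j with
  | leaf =>
    obtain rfl : j = 0 := by simpa [arity] using hj
    simp [graft, toComp, List.insertComp]
  | node l r hl hr =>
    rw [arity] at hj
    have hsum := sum_toComp l
    rw [graft]
    split_ifs with h
    · rw [toComp, toComp, hl h]
      rcases eq_or_ne l.toComp [] with h0 | h0
      · rw [h0, List.sum_nil] at hsum
        obtain rfl : j = 0 := by omega
        simp [h0, List.addLast, List.insertComp]
      · rw [List.insertComp_addLast_append h0 (toComp_pos l) _ (by omega) ht']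
    · obtain ⟨k, rfl⟩ : ∃ k, j = (l.toComp.addLast 1).sum + k :=
        ⟨j - l.arity, by rw [List.sum_addLast]; omega⟩
      rw [List.sum_addLast] at hj h
      rw [toComp, toComp,
        List.insertComp_append _ _ _ _ (List.pos_of_mem_addLast one_pos (toComp_pos l)),
        ← hr (by omega), List.sum_addLast]
      congr 3
      omega

lemma toComp_graft_congr (r : BTree) (i : ℕ) {s s' : BTree} (h : s.toComp = s'.toComp) :
    (r.graft i s).toComp = (r.graft i s').toComp := by
  induction r generalizing i with
  | leaf => rw [graft, graft]; split_ifs <;> [exact h; rfl]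
  | node l r hl hr =>
    rw [graft, graft]
    split_ifs
    · rw [toComp, toComp, hl]
    · rw [toComp, toComp, hr]

/-- Graft a corolla of degree `1` onto the last leaf. -/
def growRight : BTree → BTree
  | leaf => node leaf leaf
  | node l r => node l r.growRight

lemma toComp_growRight (t : BTree) : t.growRight.toComp = t.toComp ++ [1] := by
  induction t with
  | leaf => simp [growRight, toComp, List.addLast]
  | node l r _ hr => simp [growRight, toComp, hr]

/-- Iterated grafting on top of a corolla of degree `1`, on the left. -/
def growLeft (k : ℕ) (t : BTree) : BTree :=
  (fun s => node s leaf)^[k] t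

lemma growLeft_succ (k : ℕ) (t : BTree) : growLeft (k + 1) t = node (growLeft k t) leaf :=
  Function.iterate_succ_apply' _ _ _

lemma exists_growLeft_growRight_eq_node (k : ℕ) (t : BTree) :
    ∃ l r, growLeft k t.growRight = node l r := by
  cases k with
  | zero => cases t <;> exact ⟨_, _, rfl⟩
  | succ k => exact ⟨_, _, growLeft_succ _ _⟩

/-- The canonical binary tree encoded by a composition. -/
def ofComp (l : List ℕ) : BTree :=
  l.foldl (fun t x => growLeft (x - 1) t.growRight) leaf

lemma ofComp_concat (l : List ℕ) (x : ℕ) :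
    ofComp (l ++ [x]) = growLeft (x - 1) (ofComp l).growRight := by
  simp [ofComp]

lemma toComp_growLeft_growRight (k : ℕ) (t : BTree) :
    (growLeft k t.growRight).toComp = t.toComp ++ [k + 1] := by
  induction k with
  | zero => exact toComp_growRight t
  | succ k ih => simp [growLeft_succ, toComp, ih, List.addLast_concat]

lemma toComp_ofComp (l : List ℕ) (hl : ∀ x ∈ l, 0 < x) : (ofComp l).toComp = l := by
  induction l using List.reverseRecOn with
  | nil => rfl
  | append_singleton l x ih =>
    have hx : 0 < x := hl x (by simp)
    rw [ofComp_concat, toComp_growLeft_growRight, ih fun y hy => hl y (by simp [hy]),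
      Nat.sub_add_cancel hx]

end BTree

open BTree

lemma Step.node_left {R : BTree → BTree → Prop} {t t' : BTree} (h : Step R t t') (u : BTree) :
    Step R (node t u) (node t' u) := by
  obtain ⟨s, s', r, i, rs, hR, h1, hi, hlen, rfl, rfl⟩ := h
  exact ⟨s, s', node r u, i, rs, hR, h1, by rw [arity]; omega, hlen,
    by rw [graft, if_pos hi], by rw [graft, if_pos hi]⟩

lemma Step.node_right {R : BTree → BTree → Prop} {t t' : BTree} (h : Step R t t') (u : BTree) :
    Step R (node u t) (node u t') := by
  obtain ⟨s, s', r, i, rs, hR, h1, hi, hlen, rfl, rfl⟩ := h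
  have hlt : ¬ i + u.arity ≤ u.arity := by omega
  exact ⟨s, s', node u r, i + u.arity, rs, hR, by omega, by rw [arity]; omega, hlen,
    by rw [graft, if_neg hlt, Nat.add_sub_cancel], by rw [graft, if_neg hlt, Nat.add_sub_cancel]⟩

lemma CongrGen.map {R : BTree → BTree → Prop} {f : BTree → BTree}
    (hf : ∀ {t t'}, Step R t t' → CongrGen R (f t) (f t')) {t t' : BTree}
    (h : CongrGen R t t') : CongrGen R (f t) (f t') := by
  induction h with
  | rel _ _ h => exact hf h
  | refl _ => exact .refl _
  | symm _ _ _ ih => exact .symm _ _ ih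
  | trans _ _ _ _ _ ih₁ ih₂ => exact .trans _ _ _ ih₁ ih₂

lemma CongrGen.node {R : BTree → BTree → Prop} {t t' u u' : BTree} (ht : CongrGen R t t')
    (hu : CongrGen R u u') : CongrGen R (node t u) (node t' u') :=
  .trans _ _ _ (ht.map (f := fun t => .node t u) fun h => .rel _ _ (h.node_left u))
    (hu.map fun h => .rel _ _ (h.node_right t'))

lemma multigraft_cubic_two (a b c d : BTree) :
    (cubic 2).multigraft [a, b, c, d] = node a (node (node b c) d) := by
  simp [cubic, multigraft, arity]

lemma multigraft_cubic_four (a b c d : BTree) :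
    (cubic 4).multigraft [a, b, c, d] = node (node a (node b c)) d := by
  simp [cubic, multigraft, arity]

lemma MagCongr.rotate (a b c d : BTree) :
    MagCongr 2 4 (node a (node (node b c) d)) (node (node a (node b c)) d) :=
  .rel _ _ ⟨cubic 2, cubic 4, leaf, 1, [a, b, c, d], ⟨rfl, rfl⟩, le_rfl, le_rfl, rfl,
    by simp [graft, multigraft_cubic_two], by simp [graft, multigraft_cubic_four]⟩

lemma exists_eq_multigraft_cubic {s s' : BTree} {rs : List BTree}
    (h : s = cubic 2 ∧ s' = cubic 4) (hlen : rs.length = s.arity) :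
    ∃ a b c d, s.multigraft rs = node a (node (node b c) d) ∧
      s'.multigraft rs = node (node a (node b c)) d := by
  obtain ⟨rfl, rfl⟩ := h
  have hlen : rs.length = 4 := hlen
  obtain ⟨a, b, c, d, rfl⟩ : ∃ a b c d, rs = [a, b, c, d] := by
    match rs, hlen with
    | [a, b, c, d], _ => exact ⟨a, b, c, d, rfl⟩
  exact ⟨a, b, c, d, multigraft_cubic_two .., multigraft_cubic_four ..⟩

lemma toComp_rotate (a b c d : BTree) :
    (node a (node (node b c) d)).toComp = (node (node a (node b c)) d).toComp := by
  simp only [toComp]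
  rw [List.addLast_append _ (List.addLast 1 a.toComp) (by simp [List.addLast_ne_nil]),
    List.append_assoc]

lemma MagCongr.toComp_eq {t t' : BTree} (h : MagCongr 2 4 t t') : t.toComp = t'.toComp := by
  induction h with
  | rel _ _ h =>
    obtain ⟨s, s', r, i, rs, hR, -, -, hlen, rfl, rfl⟩ := h
    obtain ⟨a, b, c, d, h₁, h₂⟩ := exists_eq_multigraft_cubic hR hlen
    rw [h₁, h₂]
    exact toComp_graft_congr r i (toComp_rotate a b c d)
  | refl _ => rfl
  | symm _ _ _ ih => exact ih.symm
  | trans _ _ _ _ _ ih₁ ih₂ => exact ih₁.trans ih₂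

lemma growRight_graft_congr (r : BTree) {i : ℕ} {s s' : BTree}
    (h : MagCongr 2 4 s s') (hg : MagCongr 2 4 s.growRight s'.growRight) :
    MagCongr 2 4 (r.graft i s).growRight (r.graft i s').growRight := by
  have graft_congr : ∀ (r : BTree) (i : ℕ), MagCongr 2 4 (r.graft i s) (r.graft i s') := by
    intro r
    induction r with
    | leaf => intro i; rw [graft, graft]; split_ifs <;> [exact h; exact .refl _]
    | node l r hl hr =>
      intro i
      rw [graft, graft]
      split_ifs
      · exact CongrGen.node (hl _) (.refl _)
      · exact CongrGen.node (.refl _) (hr _)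
  induction r generalizing i with
  | leaf => rw [graft, graft]; split_ifs <;> [exact hg; exact .refl _]
  | node l r _ hr =>
    rw [graft, graft]
    split_ifs
    · exact CongrGen.node (graft_congr l i) (.refl _)
    · exact CongrGen.node (.refl _) hr

lemma MagCongr.growRight {t t' : BTree} (h : MagCongr 2 4 t t') :
    MagCongr 2 4 t.growRight t'.growRight := by
  refine CongrGen.map (fun h => ?_) h
  obtain ⟨s, s', r, i, rs, hR, -, -, hlen, rfl, rfl⟩ := h
  obtain ⟨a, b, c, d, h₁, h₂⟩ := exists_eq_multigraft_cubic hR hlen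
  rw [h₁, h₂]
  exact growRight_graft_congr r (.rotate a b c d) (.rotate a b c d.growRight)

lemma MagCongr.ofComp_append {u v : List ℕ} (hu : ∀ x ∈ u, 0 < x) (hv : ∀ x ∈ v, 0 < x) :
    MagCongr 2 4 (ofComp (u.addLast 1 ++ v)) (node (ofComp u) (ofComp v)) := by
  induction v using List.reverseRecOn with
  | nil =>
    induction u using List.reverseRecOn with
    | nil => exact .refl _
    | append_singleton u x _ =>
      obtain ⟨y, rfl⟩ := Nat.exists_eq_add_one.2 (hu x (by simp))
      rw [List.addLast_concat, List.append_nil, ofComp_concat, ofComp_concat]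
      simp only [Nat.add_sub_cancel, growLeft_succ]
      exact .refl _
  | append_singleton v x ih =>
    obtain ⟨y, rfl⟩ := Nat.exists_eq_add_one.2 (hv x (by simp))
    rw [← List.append_assoc, ofComp_concat, ofComp_concat, Nat.add_sub_cancel]
    have ih := ih fun x hx => hv x (by simp [hx])
    clear hv
    induction y with
    | zero => exact MagCongr.growRight ih
    | succ y ihy =>
      rw [growLeft_succ, growLeft_succ]
      refine .trans _ _ _ (CongrGen.node ihy (.refl _)) ?_
      obtain ⟨l, r, h⟩ := exists_growLeft_growRight_eq_node y (ofComp v)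
      rw [h]
      exact .symm _ _ (MagCongr.rotate _ _ _ _)

lemma magCongr_ofComp_toComp (t : BTree) : MagCongr 2 4 t (ofComp t.toComp) := by
  induction t with
  | leaf => exact .refl _
  | node l r hl hr =>
    exact .trans _ _ _ (CongrGen.node hl hr)
      (.symm _ _ (MagCongr.ofComp_append (toComp_pos l) (toComp_pos r)))

lemma magCongr_iff_toComp_eq (t t' : BTree) : MagCongr 2 4 t t' ↔ t.toComp = t'.toComp :=
  ⟨MagCongr.toComp_eq, fun h => .trans _ _ _ (magCongr_ofComp_toComp t)
    (by rw [h]; exact .symm _ _ (magCongr_ofComp_toComp _))⟩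

/-- Combinatorial realization of `Mag^{2,4}` on integer compositions: there is
an arity-preserving bijection `φ` between `≡_{2,4}`-classes and integer
compositions, sending the class of the leaf to the empty composition and
transporting grafting to the partial compositions `∘ᵢ⁽²'⁴⁾`. -/
theorem stmt19 : ∃ φ : BTree → List ℕ,
    (∀ t : BTree, (∀ x ∈ φ t, 0 < x) ∧ 1 + (φ t).sum = t.arity) ∧
    φ BTree.leaf = [] ∧
    (∀ t t' : BTree, MagCongr 2 4 t t' ↔ φ t = φ t') ∧
    (∀ l : List ℕ, (∀ x ∈ l, 0 < x) → ∃ t : BTree, φ t = l) ∧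
    -- case μ = ε
    (∀ (t t' : BTree) (i : ℕ), 1 ≤ i → i ≤ t.arity → φ t' = [] →
      φ (t.graft i t') = φ t) ∧
    -- case i = s_{1,k}(λ) (with λ_{k+1} read as 0 when k = p)
    (∀ (t t' : BTree) (i k : ℕ), 1 ≤ i → i ≤ t.arity → φ t' ≠ [] →
      k ≤ (φ t).length → i = 1 + ((φ t).take k).sum →
      φ (t.graft i t') =
        (φ t).take k ++ (φ t').dropLast ++
          ((φ t').getLastD 0 + (φ t).getD k 0) :: (φ t).drop (k + 1)) ∧
    -- otherwise, with k such that s_{1,k}(λ) < i < s_{1,k+1}(λ)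
    (∀ (t t' : BTree) (i k : ℕ), 1 ≤ i → i ≤ t.arity → φ t' ≠ [] →
      1 + ((φ t).take k).sum < i → i < 1 + ((φ t).take (k + 1)).sum →
      φ (t.graft i t') =
        (φ t).take k ++ (i - (1 + ((φ t).take k).sum)) ::
          ((φ t').dropLast ++
            ((φ t').getLastD 0 + ((1 + ((φ t).take (k + 1)).sum) - i)) :: (φ t).drop (k + 1))) := by
  refine ⟨toComp, fun t => ⟨toComp_pos t, sum_toComp t⟩, rfl, magCongr_iff_toComp_eq,
    fun l hl => ⟨ofComp l, toComp_ofComp l hl⟩, ?_, ?_, ?_⟩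
  · intro t t' i _ _ h
    rw [toComp_eq_nil.1 h, graft_leaf]
  · rintro t t' i k - hi h - rfl
    rw [add_comm, toComp_graft t h (by omega), List.insertComp_sum_take (toComp_pos t) h]
  · intro t t' i k h1 hi h h₁ h₂
    obtain ⟨j, rfl⟩ := Nat.exists_eq_add_of_le' h1
    rw [toComp_graft t h (by omega),
      List.insertComp_of_lt_of_lt (toComp_pos t) h (j := j) (k := k) (by omega) (by omega)]
    simp only [add_comm 1, Nat.add_sub_add_right]
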